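/- arXiv:2403.15182 — 8 statements merged into one kernel-verified Lean document; each statement's English description precedes it below -/
import Mathlib

section
/- Let α, β > 1 with 1/α + 1/β = 1, let t > 0, and let ω ∈ ℝ². Then sup_{x∈ℝ²} ( −(t/β)·(‖x‖/t)^β − ⟨ω,x⟩ ) = (t/α)·‖ω‖^α, where the equality holds as an equality in the extended reals; that is, the tropical max semifield Fourier transform of the α-dilation kernel k_t(x) = −(t/β)(‖x‖/t)^β satisfies (F_{T₊}k_t)(ω) = (t/α)‖ω‖^α. -/
open scoped RealInnerProductSpace

/-- The tropical max semifield Fourier transform of the α-dilation kernel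
`k_t(x) = −(t/β)(‖x‖/t)^β` equals `(t/α)‖ω‖^α` (equality in the extended reals). -/
theorem tropical_max_fourier_dilation_kernel (α β : ℝ) (hα : 1 < α) (hβ : 1 < β)
    (hαβ : 1/α + 1/β = 1) (t : ℝ) (ht : 0 < t) (ω : EuclideanSpace ℝ (Fin 2)) :
    (⨆ (x : EuclideanSpace ℝ (Fin 2)),
        ((-(t/β) * (‖x‖/t) ^ β - ⟪ω, x⟫ : ℝ) : EReal))
      = (((t/α) * ‖ω‖ ^ α : ℝ) : EReal) := by
  have hpq : α.HolderConjugate β := by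
    rw [Real.holderConjugate_iff]
    exact ⟨hα, by simpa [one_div] using hαβ⟩
  apply le_antisymm
  · refine iSup_le fun x => ?_
    rw [EReal.coe_le_coe_iff]
    have h1 := Real.young_inequality_of_nonneg (norm_nonneg ω)
      (div_nonneg (norm_nonneg x) ht.le) hpq
    have h2 : -⟪ω, x⟫ ≤ ‖ω‖ * ‖x‖ := (neg_le_abs _).trans (abs_real_inner_le_norm ω x)
    have h3 := mul_le_mul_of_nonneg_left h1 ht.le
    have h4 : t * (‖ω‖ * (‖x‖ / t)) = ‖ω‖ * ‖x‖ := by field_simp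
    have h5 : t * (‖ω‖ ^ α / α + (‖x‖ / t) ^ β / β)
        = t / α * ‖ω‖ ^ α + t / β * (‖x‖ / t) ^ β := by ring
    linarith
  · by_cases hω : ω = 0
    · refine le_iSup_of_le 0 ?_
      rw [EReal.coe_le_coe_iff]
      subst hω
      simp [Real.zero_rpow hpq.ne_zero, Real.zero_rpow hpq.symm.ne_zero]
    · have hn : 0 < ‖ω‖ := norm_pos_iff.mpr hω
      refine le_iSup_of_le ((-(t * ‖ω‖ ^ (α - 1) / ‖ω‖)) • ω) ?_
      rw [EReal.coe_le_coe_iff]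
      have hb : 0 < ‖ω‖ ^ (α - 1) := Real.rpow_pos_of_pos hn _
      have hx : ‖(-(t * ‖ω‖ ^ (α - 1) / ‖ω‖)) • ω‖ / t = ‖ω‖ ^ (α - 1) := by
        rw [norm_smul, norm_neg, Real.norm_of_nonneg (by positivity)]
        field_simp
      have hi : ⟪ω, (-(t * ‖ω‖ ^ (α - 1) / ‖ω‖)) • ω⟫ = -(t * (‖ω‖ * ‖ω‖ ^ (α - 1))) := by
        rw [real_inner_smul_right, real_inner_self_eq_norm_sq]
        field_simp
      have hy := (Real.young_inequality_eq_iff_of_nonneg hn.le hb.le hpq).mpr (by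
        rw [← Real.rpow_mul hn.le, hpq.sub_one_mul_conj])
      rw [hx, hi, hy]
      apply le_of_eq
      ring
end

section
/- Let p > 0, t > 0 and ω ∈ ℝ². The root-semifield Fourier transform of the quadratic root scale-space kernel k_t(x) = (2πt)^{-1/p}·exp(−‖x‖²/(2pt)) equals exp(−(t/(2p))·‖ω‖²); that is, ( ∫_{ℝ²} k_t(x)^p · exp(−i⟨ω,x⟩) dx )^{1/p} = exp(−(t/(2p))·‖ω‖²), where the integral is a positive real number. -/
open scoped RealInnerProductSpace

/-- The root-semifield Fourier transform of the quadratic root scale-space kernel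
`k_t(x) = (2πt)^{-1/p} exp(−‖x‖²/(2pt))` equals `exp(−(t/(2p))‖ω‖²)`:
`(∫ k_t(x)^p e^{−i⟪ω,x⟫} dx)^{1/p} = exp(−(t/(2p))‖ω‖²)`,
where the integral is a positive real number. -/
theorem root_fourier_quadratic_root_kernel (p : ℝ) (hp : 0 < p)
    (t : ℝ) (ht : 0 < t) (ω : EuclideanSpace ℝ (Fin 2)) :
    ∃ r : ℝ, 0 < r ∧
      (∫ x : EuclideanSpace ℝ (Fin 2),
          ((((2 * Real.pi * t) ^ (-1/p) * Real.exp (-‖x‖^2 / (2*p*t)) : ℝ) ^ p : ℝ) : ℂ)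
            * Complex.exp (-Complex.I * (⟪ω, x⟫ : ℝ))) = (r : ℂ) ∧
      r ^ (1/p) = Real.exp (-(t/(2*p)) * ‖ω‖^2) := by
  have h2 : 0 < 2 * Real.pi * t := by positivity
  refine ⟨Real.exp (-(t/2) * ‖ω‖^2), Real.exp_pos _, ?_, ?_⟩
  · have hk : ∀ x : EuclideanSpace ℝ (Fin 2),
        ((((2 * Real.pi * t) ^ (-1/p) * Real.exp (-‖x‖^2 / (2*p*t)) : ℝ) ^ p : ℝ) : ℂ)
            * Complex.exp (-Complex.I * (⟪ω, x⟫ : ℝ)) =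
        ((2 * Real.pi * t : ℝ) : ℂ)⁻¹ *
          Complex.exp (-((1 / (2 * t) : ℝ) : ℂ) * ‖x‖ ^ 2 + (-Complex.I) * (⟪ω, x⟫ : ℝ)) := by
      intro x
      have h : ((2 * Real.pi * t) ^ (-1/p) * Real.exp (-‖x‖^2 / (2*p*t)) : ℝ) ^ p =
          (2 * Real.pi * t)⁻¹ * Real.exp (-(1 / (2 * t)) * ‖x‖ ^ 2) := by
        rw [Real.mul_rpow (by positivity) (Real.exp_pos _).le, ← Real.rpow_mul h2.le,
          ← Real.exp_mul, div_mul_cancel₀ _ hp.ne', Real.rpow_neg_one]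
        congr 2
        field_simp
      rw [h, Complex.exp_add]
      push_cast
      ring
    have hb : 0 < (((1 / (2 * t) : ℝ) : ℂ)).re := by
      rw [Complex.ofReal_re]
      positivity
    simp_rw [hk]
    rw [MeasureTheory.integral_const_mul,
      GaussianFourier.integral_cexp_neg_mul_sq_norm_add hb (-Complex.I) ω]
    have ht' : (t : ℂ) ≠ 0 := by exact_mod_cast ht.ne'
    have hpi : (Real.pi : ℂ) ≠ 0 := by exact_mod_cast Real.pi_ne_zero
    have e1 : ((Module.finrank ℝ (EuclideanSpace ℝ (Fin 2)) : ℂ) / 2) = 1 := by simp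
    have e2 : (-Complex.I) ^ 2 * (‖ω‖ : ℂ) ^ 2 / (4 * ((1 / (2 * t) : ℝ) : ℂ)) =
        ((-(t/2) * ‖ω‖^2 : ℝ) : ℂ) := by
      rw [neg_sq, Complex.I_sq]
      push_cast
      field_simp
      ring
    rw [e1, e2, Complex.cpow_one, Complex.ofReal_exp, ← mul_assoc]
    have e3 : ((2 * Real.pi * t : ℝ) : ℂ)⁻¹ * ((Real.pi : ℂ) / ((1 / (2 * t) : ℝ) : ℂ)) = 1 := by
      push_cast
      field_simp
    rw [e3, one_mul]
  · rw [← Real.exp_mul]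
    congr 1
    field_simp
end

section
/- Let μ ≠ 0, t > 0 and ω ∈ ℝ². The logarithmic-semifield Fourier transform of the quadratic logarithmic scale-space kernel k_t(x) = −(1/μ)·ln(2πt) − ‖x‖²/(2μt) equals −(t/(2μ))·‖ω‖²; that is, (1/μ)·ln( ∫_{ℝ²} exp(μ·k_t(x)) · exp(−i⟨ω,x⟩) dx ) = −(t/(2μ))·‖ω‖², where the integral is a positive real number. -/
open scoped RealInnerProductSpace

/-- The logarithmic-semifield Fourier transform of the quadratic logarithmic scale-space
kernel `k_t(x) = −(1/μ)ln(2πt) − ‖x‖²/(2μt)` equals `−(t/(2μ))‖ω‖²`: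
`(1/μ)·ln(∫ e^{μ k_t(x)} e^{−i⟪ω,x⟫} dx) = −(t/(2μ))‖ω‖²`,
where the integral is a positive real number. -/
theorem log_fourier_quadratic_log_kernel (μ : ℝ) (hμ : μ ≠ 0)
    (t : ℝ) (ht : 0 < t) (ω : EuclideanSpace ℝ (Fin 2)) :
    ∃ r : ℝ, 0 < r ∧
      (∫ x : EuclideanSpace ℝ (Fin 2),
          ((Real.exp (μ * (-(1/μ) * Real.log (2 * Real.pi * t) - ‖x‖^2 / (2*μ*t))) : ℝ) : ℂ)
            * Complex.exp (-Complex.I * (⟪ω, x⟫ : ℝ))) = (r : ℂ) ∧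
      (1/μ) * Real.log r = -(t/(2*μ)) * ‖ω‖^2 := by
  have hpt : 0 < 2 * Real.pi * t := by positivity
  refine ⟨Real.exp (-(t / 2) * ‖ω‖ ^ 2), Real.exp_pos _, ?_, ?_⟩
  · have hb : 0 < (((1 / (2 * t) : ℝ)) : ℂ).re := by
      rw [Complex.ofReal_re]; positivity
    have key := GaussianFourier.integral_cexp_neg_mul_sq_norm_add_of_euclideanSpace hb
      (-Complex.I) ω
    have hfun : ∀ x : EuclideanSpace ℝ (Fin 2),
        ((Real.exp (μ * (-(1/μ) * Real.log (2 * Real.pi * t) - ‖x‖^2 / (2*μ*t))) : ℝ) : ℂ)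
            * Complex.exp (-Complex.I * (⟪ω, x⟫ : ℝ))
          = ((2 * Real.pi * t : ℝ) : ℂ)⁻¹ *
            Complex.exp (-((1 / (2 * t) : ℝ) : ℂ) * (‖x‖ : ℂ) ^ 2
              + -Complex.I * (⟪ω, x⟫ : ℝ)) := by
      intro x
      have h1 : μ * (-(1/μ) * Real.log (2 * Real.pi * t) - ‖x‖^2 / (2*μ*t))
          = -Real.log (2 * Real.pi * t) + -(1 / (2 * t)) * ‖x‖ ^ 2 := by
        field_simp
        ring
      rw [h1, Real.exp_add, Real.exp_neg, Real.exp_log hpt, Complex.exp_add]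
      push_cast
      ring
    simp_rw [hfun]
    rw [MeasureTheory.integral_const_mul, key]
    have ht' : (t : ℂ) ≠ 0 := by exact_mod_cast ht.ne'
    have hpi : (Real.pi : ℂ) ≠ 0 := by exact_mod_cast Real.pi_ne_zero
    have h2 : ((Fintype.card (Fin 2) : ℂ) / 2) = 1 := by simp
    rw [h2, Complex.cpow_one]
    have h3 : (-Complex.I) ^ 2 * (‖ω‖ : ℂ) ^ 2 / (4 * ((1 / (2 * t) : ℝ) : ℂ))
        = ((-(t / 2) * ‖ω‖ ^ 2 : ℝ) : ℂ) := by
      rw [neg_sq, Complex.I_sq]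
      push_cast
      field_simp
      ring
    rw [h3, Complex.ofReal_exp, ← mul_assoc]
    have h4 : ((2 * Real.pi * t : ℝ) : ℂ)⁻¹ * ((Real.pi : ℂ) / ((1 / (2 * t) : ℝ) : ℂ)) = 1 := by
      push_cast
      field_simp
    rw [h4, one_mul]
  · rw [Real.log_exp]
    field_simp
end

section
/- Let β > 1, s, t > 0 and x ∈ ℝ². Then inf_{y∈ℝ²} ( (s/β)·(‖x−y‖/s)^β + (t/β)·(‖y‖/t)^β ) = ((s+t)/β)·(‖x‖/(s+t))^β. That is, the α-erosion kernels k_t(x) = (t/β)(‖x‖/t)^β satisfy the semigroup property k_s ⊟ k_t = k_{s+t} under inf-convolution. -/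
/-- The α-erosion kernels `k_t(x) = (t/β)(‖x‖/t)^β` satisfy the semigroup property
`k_s ⊟ k_t = k_{s+t}` under inf-convolution. -/
theorem erosion_kernel_infConv_semigroup (β : ℝ) (hβ : 1 < β) (s t : ℝ)
    (hs : 0 < s) (ht : 0 < t) (x : EuclideanSpace ℝ (Fin 2)) :
    (⨅ (y : EuclideanSpace ℝ (Fin 2)),
        (s/β) * (‖x - y‖/s) ^ β + (t/β) * (‖y‖/t) ^ β)
      = ((s + t)/β) * (‖x‖/(s + t)) ^ β := by
  have hβ0 : 0 < β := by linarith
  have hst : 0 < s + t := by linarith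
  apply le_antisymm
  · have hb : BddBelow (Set.range fun y : EuclideanSpace ℝ (Fin 2) =>
        (s/β) * (‖x - y‖/s) ^ β + (t/β) * (‖y‖/t) ^ β) := by
      refine ⟨0, ?_⟩
      rintro _ ⟨y, rfl⟩
      positivity
    refine (ciInf_le hb ((t/(s+t)) • x)).trans (le_of_eq ?_)
    have h1 : x - (t/(s+t)) • x = (s/(s+t)) • x := by
      have : s/(s+t) = 1 - t/(s+t) := by field_simp; ring
      rw [this, sub_smul, one_smul]
    have h2 : ‖(s/(s+t)) • x‖ / s = ‖x‖/(s+t) := by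
      rw [norm_smul, Real.norm_of_nonneg (by positivity)]
      field_simp
    have h3 : ‖(t/(s+t)) • x‖ / t = ‖x‖/(s+t) := by
      rw [norm_smul, Real.norm_of_nonneg (by positivity)]
      field_simp
    rw [h1, h2, h3]
    ring
  · refine le_ciInf fun y => ?_
    have hx0 : ‖x - y‖/s ∈ Set.Ici (0 : ℝ) := Set.mem_Ici.2 (by positivity)
    have hy0 : ‖y‖/t ∈ Set.Ici (0 : ℝ) := Set.mem_Ici.2 (by positivity)
    have ha : 0 ≤ s/(s+t) := by positivity
    have hb : 0 ≤ t/(s+t) := by positivity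
    have hab : s/(s+t) + t/(s+t) = 1 := by field_simp
    have hc := (convexOn_rpow hβ.le).2 hx0 hy0 ha hb hab
    simp only [smul_eq_mul] at hc
    have e : s/(s+t) * (‖x - y‖/s) + t/(s+t) * (‖y‖/t) = (‖x - y‖ + ‖y‖)/(s+t) := by
      field_simp
    rw [e] at hc
    have hn : ‖x‖ ≤ ‖x - y‖ + ‖y‖ := by simpa using norm_add_le (x - y) y
    have hm : (‖x‖/(s+t)) ^ β ≤ ((‖x - y‖ + ‖y‖)/(s+t)) ^ β :=
      Real.rpow_le_rpow (by positivity) (by gcongr) hβ0.le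
    have := mul_le_mul_of_nonneg_left (hm.trans hc) (show 0 ≤ (s+t)/β by positivity)
    refine this.trans (le_of_eq ?_)
    generalize (‖x - y‖/s) ^ β = A
    generalize (‖y‖/t) ^ β = B
    field_simp
end

section
/- Let α, β > 1 with 1/α + 1/β = 1, and define k(x,t) = −(t/β)·(‖x‖/t)^β for x ∈ ℝ², t > 0. Then for every t > 0 and every x ≠ 0, ∂k/∂t (x,t) = (1/α)·‖∇_x k(·,t)(x)‖^α, i.e. the α-dilation kernel satisfies the α-dilation PDE ∂f/∂t = (1/α)‖∇f‖^α. Explicitly, ∂k/∂t (x,t) = (1/α)(‖x‖/t)^β and ‖∇_x k(·,t)(x)‖ = (‖x‖/t)^{β−1}. -/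
/-- The α-dilation kernel `k_t(x) = −(t/β)(‖x‖/t)^β` (with `1/α + 1/β = 1`) satisfies the
α-dilation PDE `∂f/∂t = (1/α)‖∇f‖^α` for `x ≠ 0`: explicitly, the time derivative is
`(1/α)(‖x‖/t)^β`, the spatial gradient `g` has norm `(‖x‖/t)^{β−1}`, and the time
derivative equals `(1/α)‖g‖^α`. -/
theorem dilation_kernel_satisfies_pde (α β : ℝ) (hα : 1 < α) (hβ : 1 < β)
    (hαβ : 1/α + 1/β = 1) (t : ℝ) (ht : 0 < t)
    (x : EuclideanSpace ℝ (Fin 2)) (hx : x ≠ 0) :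
    ∃ g : EuclideanSpace ℝ (Fin 2),
      HasDerivAt (fun τ : ℝ => -(τ/β) * (‖x‖/τ) ^ β) ((1/α) * (‖x‖/t) ^ β) t ∧
      HasGradientAt (fun y : EuclideanSpace ℝ (Fin 2) => -(t/β) * (‖y‖/t) ^ β) g x ∧
      ‖g‖ = (‖x‖/t) ^ (β - 1) ∧
      (1/α) * (‖x‖/t) ^ β = (1/α) * ‖g‖ ^ α := by
  have hr : 0 < ‖x‖ := norm_pos_iff.mpr hx
  have hα0 : α ≠ 0 := by positivity
  have hβ0 : β ≠ 0 := by positivity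
  have hu : 0 < ‖x‖ / t := by positivity
  have h1α : 1 / α = 1 - 1 / β := by linarith
  have hmul : (β - 1) * α = β := by
    field_simp at hαβ
    linarith
  have hnorm : ‖(-(t / β) * ((t ^ β)⁻¹ * (β * ‖x‖ ^ (β - 2)))) • x‖ = (‖x‖ / t) ^ (β - 1) := by
    have e1 : ‖x‖ ^ (β - 1) = ‖x‖ ^ (β - 2) * ‖x‖ := by
      rw [← Real.rpow_add_one hr.ne']
      congr 1
      ring
    have e2 : t ^ β = t ^ (β - 1) * t := by
      rw [← Real.rpow_add_one ht.ne']
      congr 1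
      ring
    have htp : 0 < t ^ (β - 1) := Real.rpow_pos_of_pos ht _
    rw [norm_smul, Real.div_rpow hr.le ht.le, e1, e2, neg_mul, norm_neg, Real.norm_of_nonneg
      (by positivity)]
    field_simp
  refine ⟨(-(t / β) * ((t ^ β)⁻¹ * (β * ‖x‖ ^ (β - 2)))) • x, ?_, ?_, hnorm, ?_⟩
  · have hd : HasDerivAt (fun τ : ℝ => ‖x‖ / τ) (-‖x‖ / t ^ 2) t := by
      have := (hasDerivAt_inv ht.ne').const_mul ‖x‖
      exact this.congr_deriv (by ring)
    have hp := hd.rpow_const (p := β) (Or.inl hu.ne')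
    have hl : HasDerivAt (fun τ : ℝ => -(τ / β)) (-(1 / β)) t :=
      ((hasDerivAt_id t).div_const β).neg
    refine (hl.mul hp).congr_deriv ?_
    have e : (‖x‖ / t) ^ β = (‖x‖ / t) ^ (β - 1) * (‖x‖ / t) := by
      rw [← Real.rpow_add_one hu.ne']
      congr 1
      ring
    rw [h1α, e]
    field_simp
    ring
  · rw [hasGradientAt_iff_hasFDerivAt]
    have h := ((hasFDerivAt_norm_rpow x hβ).const_mul ((t ^ β)⁻¹)).const_mul (-(t / β))
    have hf : (fun y : EuclideanSpace ℝ (Fin 2) => -(t/β) * (‖y‖/t) ^ β)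
        = fun y => -(t / β) * ((t ^ β)⁻¹ * ‖y‖ ^ β) := by
      funext y
      rw [Real.div_rpow (norm_nonneg _) ht.le]
      ring
    rw [hf]
    refine h.congr_fderiv ?_
    refine ContinuousLinearMap.ext fun y => ?_
    simp only [InnerProductSpace.toDual_apply_apply, real_inner_smul_left,
      ContinuousLinearMap.smul_apply, innerSL_apply_apply, smul_eq_mul]
    ring
  · rw [hnorm, ← Real.rpow_mul hu.le, hmul]
end

section
/- Let μ ≠ 0 and let f : ℝ² × (0,∞) → ℝ be strictly positive and smooth (C²), satisfying the heat equation ∂f/∂t = (1/2)·Δ_x f. Define g(x,t) = (1/μ)·ln f(x,t). Then g satisfies the quadratic logarithmic scale-space PDE: ∂g/∂t = (μ/2)·‖∇_x g‖² + (1/2)·Δ_x g. -/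
/-- The Laplacian of `f : ℝ² → ℝ` at `x`: the sum of the second partial derivatives of `f`
along the standard orthonormal basis. -/
noncomputable def laplacian (f : EuclideanSpace ℝ (Fin 2) → ℝ)
    (x : EuclideanSpace ℝ (Fin 2)) : ℝ :=
  ∑ i : Fin 2,
    fderiv ℝ (fun y => fderiv ℝ f y (EuclideanSpace.single i (1:ℝ))) x
      (EuclideanSpace.single i (1:ℝ))

/-- Spatial directional derivative of the logarithmic transform. -/
lemma fderiv_log_transform (μ : ℝ) (u : EuclideanSpace ℝ (Fin 2) → ℝ)
    (hu : ContDiff ℝ 2 u) (hpos : ∀ y, 0 < u y) (y e : EuclideanSpace ℝ (Fin 2)) :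
    fderiv ℝ (fun z => (1/μ) * Real.log (u z)) y e = (1/μ) * ((u y)⁻¹ * fderiv ℝ u y e) := by
  have hd : HasFDerivAt u (fderiv ℝ u y) y :=
    (hu.differentiable (by norm_num) y).hasFDerivAt
  have h := (hd.log (hpos y).ne').const_mul (1/μ)
  rw [h.fderiv]
  simp

/-- Second spatial directional derivative of the logarithmic transform. -/
lemma fderiv_fderiv_log_transform (μ : ℝ) (u : EuclideanSpace ℝ (Fin 2) → ℝ)
    (hu : ContDiff ℝ 2 u) (hpos : ∀ y, 0 < u y) (x e : EuclideanSpace ℝ (Fin 2)) :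
    fderiv ℝ (fun y => fderiv ℝ (fun z => (1/μ) * Real.log (u z)) y e) x e
      = (1/μ) * ((u x)⁻¹ * fderiv ℝ (fun y => fderiv ℝ u y e) x e
          - ((u x)⁻¹ * fderiv ℝ u x e) ^ 2) := by
  simp_rw [fderiv_log_transform μ u hu hpos]
  have hd : HasFDerivAt u (fderiv ℝ u x) x :=
    (hu.differentiable (by norm_num) x).hasFDerivAt
  have h1 : ContDiff ℝ 1 (fun y => fderiv ℝ u y e) :=
    (hu.fderiv_right (by norm_num)).clm_apply contDiff_const
  have hd2 := (h1.differentiable (by norm_num) x).hasFDerivAt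
  have hinv := (hasDerivAt_inv (hpos x).ne').comp_hasFDerivAt x hd
  have h := (hinv.mul hd2).const_mul (1/μ)
  have h' : HasFDerivAt (fun y => (1/μ) * ((u y)⁻¹ * fderiv ℝ u y e)) _ x := h
  rw [h'.fderiv]
  simp
  ring_nf

/-- The squared norm of the gradient is the sum of the squared partial derivatives. -/
lemma norm_gradient_sq (v : EuclideanSpace ℝ (Fin 2) → ℝ) (x : EuclideanSpace ℝ (Fin 2)) :
    ‖gradient v x‖ ^ 2
      = ∑ i : Fin 2, (fderiv ℝ v x (EuclideanSpace.single i (1:ℝ))) ^ 2 := by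
  rw [EuclideanSpace.real_norm_sq_eq]
  refine Finset.sum_congr rfl fun i _ => ?_
  have h : inner ℝ (gradient v x) (EuclideanSpace.single i (1:ℝ))
      = fderiv ℝ v x (EuclideanSpace.single i (1:ℝ)) := by
    simp only [gradient, InnerProductSpace.toDual_symm_apply]
  rw [← h, EuclideanSpace.inner_single_right]
  simp

/-- Cole–Hopf: if `f > 0` is `C²` on `ℝ² × (0,∞)` and satisfies the heat equation
`∂f/∂t = (1/2)Δ_x f`, then `g = (1/μ)·ln f` satisfies the quadratic logarithmic
scale-space PDE `∂g/∂t = (μ/2)‖∇_x g‖² + (1/2)Δ_x g`. -/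
theorem cole_hopf_quadratic_logarithmic_pde (μ : ℝ) (hμ : μ ≠ 0)
    (f : EuclideanSpace ℝ (Fin 2) × ℝ → ℝ)
    (hpos : ∀ (x : EuclideanSpace ℝ (Fin 2)) (t : ℝ), 0 < t → 0 < f (x, t))
    (hsmooth : ContDiffOn ℝ 2 f (Set.univ ×ˢ Set.Ioi (0:ℝ)))
    (hheat : ∀ (x : EuclideanSpace ℝ (Fin 2)) (t : ℝ), 0 < t →
      HasDerivAt (fun τ : ℝ => f (x, τ))
        ((1/2) * laplacian (fun y => f (y, t)) x) t)
    (g : EuclideanSpace ℝ (Fin 2) → ℝ → ℝ)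
    (hg : ∀ (x : EuclideanSpace ℝ (Fin 2)) (t : ℝ), g x t = (1/μ) * Real.log (f (x, t))) :
    ∀ (x : EuclideanSpace ℝ (Fin 2)) (t : ℝ), 0 < t →
      HasDerivAt (fun τ : ℝ => g x τ)
        ((μ/2) * ‖gradient (fun y => g y t) x‖^2
          + (1/2) * laplacian (fun y => g y t) x) t := by
  intro x t ht
  have hu : ContDiff ℝ 2 (fun y => f (y, t)) := by
    rw [← contDiffOn_univ]
    exact hsmooth.comp (by fun_prop) (fun y _ => ⟨trivial, ht⟩)
  have hup : ∀ y, 0 < f (y, t) := fun y => hpos y t ht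
  have hgt : (fun y => g y t) = fun y => (1/μ) * Real.log (f (y, t)) := funext fun y => hg y t
  have hgx : (fun τ => g x τ) = fun τ => (1/μ) * Real.log (f (x, τ)) := funext fun τ => hg x τ
  have h := ((hheat x t ht).log (hup x).ne').const_mul (1/μ)
  rw [hgx, hgt, norm_gradient_sq]
  refine h.congr_deriv ?_
  unfold laplacian
  rw [Fin.sum_univ_two, Fin.sum_univ_two, Fin.sum_univ_two,
    fderiv_fderiv_log_transform μ _ hu hup, fderiv_fderiv_log_transform μ _ hu hup,
    fderiv_log_transform μ _ hu hup, fderiv_log_transform μ _ hu hup]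
  have := (hup x).ne'
  field_simp
  ring
end

section
/- Let p ≠ 0 and let f : ℝ² × (0,∞) → ℝ be strictly positive and smooth (C²), satisfying the heat equation ∂f/∂t = (1/2)·Δ_x f. Define g(x,t) = f(x,t)^{1/p}. Then g satisfies the quadratic root scale-space PDE: ∂g/∂t = ((p−1)/g)·(1/2)·‖∇_x g‖² + (1/2)·Δ_x g. -/
theorem norm_gradient_sq_eq (u : EuclideanSpace ℝ (Fin 2) → ℝ) (x : EuclideanSpace ℝ (Fin 2)) :
    ‖gradient u x‖^2 = ∑ i : Fin 2, (fderiv ℝ u x (EuclideanSpace.single i (1:ℝ)))^2 := by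
  rw [EuclideanSpace.norm_sq_eq]
  refine Finset.sum_congr rfl fun i _ => ?_
  have h : inner ℝ (gradient u x) (EuclideanSpace.single i (1:ℝ))
      = fderiv ℝ u x (EuclideanSpace.single i (1:ℝ)) := by
    unfold gradient
    exact InnerProductSpace.toDual_symm_apply
  rw [← h, EuclideanSpace.inner_single_right]
  simp

theorem fderiv_rpow_apply (u : EuclideanSpace ℝ (Fin 2) → ℝ) (hu : Differentiable ℝ u)
    (hpos : ∀ y, 0 < u y) (a : ℝ) (x v : EuclideanSpace ℝ (Fin 2)) :
    fderiv ℝ (fun y => u y ^ a) x v = a * u x ^ (a - 1) * fderiv ℝ u x v := by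
  have h := (hu x).hasFDerivAt.rpow_const (p := a) (Or.inl (hpos x).ne')
  rw [h.fderiv]
  simp

theorem fderiv_two_rpow (u : EuclideanSpace ℝ (Fin 2) → ℝ) (hu : ContDiff ℝ 2 u)
    (hpos : ∀ y, 0 < u y) (a : ℝ) (x v : EuclideanSpace ℝ (Fin 2)) :
    fderiv ℝ (fun y => fderiv ℝ (fun y => u y ^ a) y v) x v
      = a * (a - 1) * u x ^ (a - 2) * (fderiv ℝ u x v)^2
        + a * u x ^ (a - 1) * fderiv ℝ (fun y => fderiv ℝ u y v) x v := by
  have hd : Differentiable ℝ u := hu.differentiable (by norm_num)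
  have hd2 : Differentiable ℝ (fun y => fderiv ℝ u y v) :=
    ((hu.fderiv_right (m := 1) (by norm_num)).clm_apply contDiff_const).differentiable
      (by norm_num)
  have e : (fun y => fderiv ℝ (fun y => u y ^ a) y v)
      = fun y => (a * u y ^ (a - 1)) * fderiv ℝ u y v := by
    funext y
    exact fderiv_rpow_apply u hd hpos a y v
  have h1 := ((hd x).hasFDerivAt.rpow_const (p := a - 1) (Or.inl (hpos x).ne')).const_mul a
  have h2 := h1.mul (hd2 x).hasFDerivAt
  rw [e]
  refine (congrArg (fun L => L v) h2.fderiv).trans ?_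
  have : a - 1 - 1 = a - 2 := by ring
  simp [this]
  ring

/-- If `f > 0` is `C²` on `ℝ² × (0,∞)` and satisfies the heat equation
`∂f/∂t = (1/2)Δ_x f`, then `g = f^{1/p}` satisfies the quadratic root scale-space PDE
`∂g/∂t = ((p−1)/g)·(1/2)‖∇_x g‖² + (1/2)Δ_x g`. -/
theorem root_transform_quadratic_root_pde (p : ℝ) (hp : p ≠ 0)
    (f : EuclideanSpace ℝ (Fin 2) × ℝ → ℝ)
    (hpos : ∀ (x : EuclideanSpace ℝ (Fin 2)) (t : ℝ), 0 < t → 0 < f (x, t))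
    (hsmooth : ContDiffOn ℝ 2 f (Set.univ ×ˢ Set.Ioi (0:ℝ)))
    (hheat : ∀ (x : EuclideanSpace ℝ (Fin 2)) (t : ℝ), 0 < t →
      HasDerivAt (fun τ : ℝ => f (x, τ))
        ((1/2) * laplacian (fun y => f (y, t)) x) t)
    (g : EuclideanSpace ℝ (Fin 2) → ℝ → ℝ)
    (hg : ∀ (x : EuclideanSpace ℝ (Fin 2)) (t : ℝ), g x t = f (x, t) ^ (1/p)) :
    ∀ (x : EuclideanSpace ℝ (Fin 2)) (t : ℝ), 0 < t →
      HasDerivAt (fun τ : ℝ => g x τ)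
        (((p - 1) / g x t) * ((1/2) * ‖gradient (fun y => g y t) x‖^2)
          + (1/2) * laplacian (fun y => g y t) x) t := by
  intro x t ht
  have hu : ContDiff ℝ 2 (fun y => f (y, t)) := by
    rw [← contDiffOn_univ]
    exact hsmooth.comp (f := fun y => (y, t))
      (contDiff_id.prodMk contDiff_const).contDiffOn (fun y _ => ⟨trivial, ht⟩)
  have hup : ∀ y, 0 < f (y, t) := fun y => hpos y t ht
  have hd : Differentiable ℝ (fun y => f (y, t)) := hu.differentiable (by norm_num)
  have hF := hup x
  simp only [hg]
  have key := (hheat x t ht).rpow_const (p := 1 / p) (Or.inl hF.ne')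
  convert key using 1
  rw [norm_gradient_sq_eq]
  unfold laplacian
  simp only [Fin.sum_univ_two]
  rw [fderiv_two_rpow _ hu hup, fderiv_two_rpow _ hu hup,
    fderiv_rpow_apply _ hd hup, fderiv_rpow_apply _ hd hup]
  have e1 : f (x, t) ^ (1 / p - 1) = f (x, t) ^ (1 / p) / f (x, t) := by
    rw [Real.rpow_sub hF, Real.rpow_one]
  have e2 : f (x, t) ^ (1 / p - 2) = f (x, t) ^ (1 / p) / f (x, t) ^ 2 := by
    rw [Real.rpow_sub hF, Real.rpow_two]
  have hG : f (x, t) ^ (1 / p) ≠ 0 := (Real.rpow_pos_of_pos hF _).ne'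
  rw [e1, e2]
  generalize f (x, t) ^ (1 / p) = G at *
  have := hF.ne'
  field_simp
  ring
end

section
/- Let κ : ℝ² × ℝ² → ℝ be continuous, and suppose the operator (Φf)(x) = ⨆_{y∈ℝ²} (κ(x,y) + f(y)) (supremum in the extended reals) commutes with all translations, in the sense that for every v ∈ ℝ², every x ∈ ℝ², and every lower semicontinuous f : ℝ² → ℝ∪{−∞} that is bounded above, one has ⨆_{y} (κ(x,y) + f(y−v)) = ⨆_{y} (κ(x−v,y) + f(y)). Then κ is translation invariant: κ(v+x, v+y) = κ(x,y) for all x, y, v ∈ ℝ². -/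
/-- Tropical max instance of Lemma 5.1: if the sup-integral operator
`(Φf)(x) = ⨆_y (κ(x,y) + f(y))` commutes with all translations on lower semicontinuous,
bounded-above functions `f : ℝ² → ℝ ∪ {−∞}`, then the continuous kernel `κ` is
translation invariant: `κ(v+x, v+y) = κ(x,y)`. -/
theorem tropical_translation_equivariance_implies_kernel_invariance
    (κ : EuclideanSpace ℝ (Fin 2) × EuclideanSpace ℝ (Fin 2) → ℝ)
    (hκ : Continuous κ)
    (h : ∀ (v x : EuclideanSpace ℝ (Fin 2)) (f : EuclideanSpace ℝ (Fin 2) → EReal),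
      LowerSemicontinuous f → (∀ y, f y ≠ ⊤) → (∃ M : ℝ, ∀ y, f y ≤ (M : EReal)) →
      (⨆ y : EuclideanSpace ℝ (Fin 2), ((κ (x, y) : EReal) + f (y - v)))
        = ⨆ y : EuclideanSpace ℝ (Fin 2), ((κ (x - v, y) : EReal) + f y)) :
    ∀ x y v : EuclideanSpace ℝ (Fin 2), κ (v + x, v + y) = κ (x, y) := by
  have key : ∀ x y v : EuclideanSpace ℝ (Fin 2), κ (v + x, v + y) ≤ κ (x, y) := by
    classical
    intro x y v
    refine le_of_forall_pos_le_add fun ε hε => ?_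
    have hg : Continuous fun z => κ (x, z) := by fun_prop
    obtain ⟨δ, hδ, hball⟩ := Metric.continuous_iff.1 hg y ε hε
    let f : EuclideanSpace ℝ (Fin 2) → EReal :=
      fun z => if z ∈ Metric.ball y δ then 0 else ⊥
    have hlsc : LowerSemicontinuous f := by
      intro z c hc
      by_cases hz : z ∈ Metric.ball y δ
      · filter_upwards [Metric.isOpen_ball.mem_nhds hz] with w hw
        simp only [f, if_pos hw]
        simpa only [f, if_pos hz] using hc
      · simp only [f, if_neg hz] at hc
        exact absurd hc not_lt_bot
    have hle : ∀ z, f z ≤ ((0 : ℝ) : EReal) := by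
      intro z
      by_cases hz : z ∈ Metric.ball y δ
      · simp only [f, if_pos hz]; simp
      · simp only [f, if_neg hz]; simp
    have hmain := h v (v + x) f hlsc
      (fun z hz => by have := hle z; rw [hz] at this; simp at this) ⟨0, hle⟩
    have h1 : (κ (v + x, v + y) : EReal) ≤
        ⨆ w : EuclideanSpace ℝ (Fin 2), ((κ (v + x, w) : EReal) + f (w - v)) := by
      refine le_trans ?_ (le_iSup _ (v + y))
      have : f (v + y - v) = 0 := by
        rw [add_sub_cancel_left]
        exact if_pos (Metric.mem_ball_self hδ)
      simp only [this, add_zero, le_refl]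
    have h2 : (⨆ w : EuclideanSpace ℝ (Fin 2), ((κ (v + x - v, w) : EReal) + f w)) ≤
        ((κ (x, y) + ε : ℝ) : EReal) := by
      rw [add_sub_cancel_left]
      refine iSup_le fun w => ?_
      by_cases hw : w ∈ Metric.ball y δ
      · simp only [f, if_pos hw, add_zero]
        have := hball w hw
        rw [Real.dist_eq] at this
        have := (abs_lt.1 this).2
        exact EReal.coe_le_coe_iff.2 (by linarith)
      · simp only [f, if_neg hw, EReal.add_bot]
        exact bot_le
    exact EReal.coe_le_coe_iff.1 (h1.trans (hmain.le.trans h2))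
  intro x y v
  refine le_antisymm (key x y v) ?_
  simpa using key (v + x) (v + y) (-v)
end
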